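/- arXiv:2512.02247 — 4 statements merged into one kernel-verified Lean document; each statement's English description precedes it below -/
import Mathlib

section
/- For parameters μ > 0, θ > 0, and α ∈ ℝ, there exists a unique p* > 0 satisfying the first-order condition (θp* - 1)·exp(α + θp*) = 1; moreover this p* satisfies θp* > 1. -/
/-- A positive value of `(x - 1)·exp(a + x)` forces `1 < x`. -/
lemma one_lt_of_sub_one_mul_exp_pos {a x : ℝ} (h : 0 < (x - 1) * Real.exp (a + x)) : 1 < x :=
  sub_pos.mp (pos_of_mul_pos_left h (Real.exp_pos _).le)

lemma strictMonoOn_sub_one_mul_exp (a : ℝ) :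
    StrictMonoOn (fun x : ℝ => (x - 1) * Real.exp (a + x)) (Set.Ici 1) := by
  intro x hx y _ hxy
  have hx' : 0 ≤ x - 1 := sub_nonneg.mpr hx
  exact mul_lt_mul'' (by linarith) (Real.exp_lt_exp.mpr (by linarith)) hx' (Real.exp_pos _).le

lemma exists_sub_one_mul_exp_eq_one (a : ℝ) : ∃ x : ℝ, (x - 1) * Real.exp (a + x) = 1 := by
  have hb : (1 : ℝ) ≤ 1 + Real.exp (-(a + 1)) := by linarith [Real.exp_pos (-(a + 1))]
  have hcont : ContinuousOn (fun x : ℝ => (x - 1) * Real.exp (a + x))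
      (Set.Icc 1 (1 + Real.exp (-(a + 1)))) := by fun_prop
  obtain ⟨x, -, hx⟩ := intermediate_value_Icc hb hcont (show (1 : ℝ) ∈ _ from by
    refine ⟨by simp, ?_⟩
    simp only [add_sub_cancel_left, ← Real.exp_add]
    exact Real.one_le_exp (by linarith [Real.exp_pos (-(a + 1))]))
  exact ⟨x, hx⟩

/-- there exists a unique `p* > 0` satisfying the first-order condition
`(θp* - 1)·exp(α + θp*) = 1`; moreover this `p*` satisfies `θp* > 1`. -/
theorem logit_foc_exists_unique (μ θ α : ℝ) (hμ : 0 < μ) (hθ : 0 < θ) :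
    (∃! p : ℝ, 0 < p ∧ (θ * p - 1) * Real.exp (α + θ * p) = 1) ∧
    (∀ p : ℝ, 0 < p → (θ * p - 1) * Real.exp (α + θ * p) = 1 → 1 < θ * p) := by
  have key {x : ℝ} (hx : (x - 1) * Real.exp (α + x) = 1) : 1 < x :=
    one_lt_of_sub_one_mul_exp_pos (hx ▸ one_pos)
  refine ⟨?_, fun p _ hp => key hp⟩
  obtain ⟨x, hx⟩ := exists_sub_one_mul_exp_eq_one α
  have hx1 := key hx
  refine ⟨x / θ, ⟨div_pos (by linarith) hθ, by rwa [mul_div_cancel₀ x hθ.ne']⟩, ?_⟩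
  rintro p ⟨-, hp⟩
  rw [eq_div_iff hθ.ne', mul_comm]
  exact (strictMonoOn_sub_one_mul_exp α).injOn (key hp).le hx1.le (hp.trans hx.symm)
end

section
/- (Theorem 1, increasing part) Let μ > 0, θ > 0, α ∈ ℝ, and let p* > 0 be a solution of the first-order condition (θp* - 1)·exp(α + θp*) = 1. Then the revenue function R(p) = p·d(p) under logit demand satisfies R'(p) > 0 for all p with 0 < p < p*, and R is strictly increasing on the interval (0, p*). -/
/-- The derivative of the revenue function under logit demand. -/
lemma hasDerivAt_logit_revenue (μ θ α p : ℝ) :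
    HasDerivAt
      (fun p : ℝ => p * (μ * Real.exp (-(α + θ * p)) / (1 + Real.exp (-(α + θ * p)))))
      (μ * Real.exp (-(α + θ * p)) * (1 + Real.exp (-(α + θ * p)) - θ * p) /
        (1 + Real.exp (-(α + θ * p))) ^ 2) p := by
  have hexp : HasDerivAt (fun p : ℝ => Real.exp (-(α + θ * p)))
      (Real.exp (-(α + θ * p)) * -(θ * 1)) p :=
    (((hasDerivAt_id p).const_mul θ).const_add α).neg.exp
  have hne : 1 + Real.exp (-(α + θ * p)) ≠ 0 := by positivity
  refine ((hasDerivAt_id p).mul ((hexp.const_mul μ).div (hexp.const_add 1) hne)).congr_deriv ?_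
  simp only [id, Pi.div_apply]
  field_simp
  ring

/-- The marginal revenue is positive to the left of a solution of the first-order condition. -/
lemma deriv_logit_revenue_pos {μ θ α pstar p : ℝ} (hμ : 0 < μ) (hθ : 0 < θ)
    (hfoc : (θ * pstar - 1) * Real.exp (α + θ * pstar) = 1) (hp : p < pstar) :
    0 < deriv (fun p : ℝ =>
      p * (μ * Real.exp (-(α + θ * p)) / (1 + Real.exp (-(α + θ * p))))) p := by
  rw [(hasDerivAt_logit_revenue μ θ α p).deriv]
  have hmul : θ * p < θ * pstar := mul_lt_mul_of_pos_left hp hθ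
  have hstar : θ * pstar - 1 = Real.exp (-(α + θ * pstar)) := by
    rw [Real.exp_neg]
    exact eq_inv_of_mul_eq_one_left hfoc
  have hexp : Real.exp (-(α + θ * pstar)) < Real.exp (-(α + θ * p)) :=
    Real.exp_lt_exp.2 (by linarith)
  have hpos : 0 < 1 + Real.exp (-(α + θ * p)) - θ * p := by linarith
  positivity

/-- Theorem 1, increasing part: if `p* > 0` solves the first-order
condition `(θp* - 1)·exp(α + θp*) = 1`, then `R'(p) > 0` for all `0 < p < p*`, and
the revenue `R(p) = p·d(p)` is strictly increasing on `(0, p*)`. -/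
theorem logit_revenue_increasing (μ θ α : ℝ) (hμ : 0 < μ) (hθ : 0 < θ)
    (pstar : ℝ) (hpstar : 0 < pstar)
    (hfoc : (θ * pstar - 1) * Real.exp (α + θ * pstar) = 1) :
    (∀ p : ℝ, 0 < p → p < pstar →
      0 < deriv (fun p : ℝ =>
        p * (μ * Real.exp (-(α + θ * p)) / (1 + Real.exp (-(α + θ * p))))) p) ∧
    StrictMonoOn
      (fun p : ℝ => p * (μ * Real.exp (-(α + θ * p)) / (1 + Real.exp (-(α + θ * p)))))
      (Set.Ioo 0 pstar) := by
  refine ⟨fun p _ hp => deriv_logit_revenue_pos hμ hθ hfoc hp,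
    strictMonoOn_of_deriv_pos (convex_Ioo 0 pstar)
      (fun p _ => (hasDerivAt_logit_revenue μ θ α p).continuousAt.continuousWithinAt)
      fun p hp => deriv_logit_revenue_pos hμ hθ hfoc ?_⟩
  exact (interior_subset hp).2
end

section
/- (Theorem 1, global maximum) Let μ > 0, θ > 0, α ∈ ℝ, and let p* > 0 be a solution of the first-order condition (θp* - 1)·exp(α + θp*) = 1. Then the revenue function R(p) = p·d(p) under logit demand attains its unique global maximum over (0, ∞) at p*: for every p > 0 with p ≠ p*, R(p) < R(p*). -/
/-- Logit demand written with the positive exponential only. -/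
lemma mul_exp_neg_div_one_add_exp_neg (μ x : ℝ) :
    μ * Real.exp (-x) / (1 + Real.exp (-x)) = μ / (Real.exp x + 1) := by
  have hx := Real.exp_pos x
  rw [Real.exp_neg]
  field_simp

/-- Theorem 1, global maximum: if `p* > 0` solves the first-order
condition `(θp* - 1)·exp(α + θp*) = 1`, then the revenue `R(p) = p·d(p)` attains its
unique global maximum over `(0, ∞)` at `p*`. -/
theorem logit_revenue_global_max (μ θ α : ℝ) (hμ : 0 < μ) (hθ : 0 < θ)
    (pstar : ℝ) (hpstar : 0 < pstar)
    (hfoc : (θ * pstar - 1) * Real.exp (α + θ * pstar) = 1) :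
    ∀ p : ℝ, 0 < p → p ≠ pstar →
      p * (μ * Real.exp (-(α + θ * p)) / (1 + Real.exp (-(α + θ * p)))) <
      pstar * (μ * Real.exp (-(α + θ * pstar)) / (1 + Real.exp (-(α + θ * pstar)))) := by
  intro p _ hne
  rw [mul_exp_neg_div_one_add_exp_neg, mul_exp_neg_div_one_add_exp_neg]
  have hE := Real.exp_pos (α + θ * p)
  have hEstar := Real.exp_pos (α + θ * pstar)
  have htangent : θ * p * Real.exp (α + θ * pstar) < Real.exp (α + θ * p) + 1 := by
    have hlt := Real.add_one_lt_exp (mul_ne_zero hθ.ne' (sub_ne_zero.mpr hne))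
    have hsplit : Real.exp (α + θ * p) =
        Real.exp (α + θ * pstar) * Real.exp (θ * (p - pstar)) := by
      rw [← Real.exp_add]
      ring_nf
    rw [hsplit]
    linarith [mul_lt_mul_of_pos_left hlt hEstar]
  have hden : Real.exp (α + θ * pstar) + 1 = θ * pstar * Real.exp (α + θ * pstar) := by
    linarith
  rw [hden, mul_div_assoc', mul_div_assoc', div_lt_div_iff₀ (by positivity) (by positivity)]
  linarith [mul_lt_mul_of_pos_left htangent (mul_pos hpstar hμ)]
end

section
/- (Proposition 4) Let μ > 0, θ > 0, and α < -2, and let p* > 0 be a solution of the first-order condition (θp* - 1)·exp(α + θp*) = 1. Then p* < p_inf, where p_inf = -α/θ is the inflection-point price of the logit demand curve; consequently the revenue satisfies R(p*) > R(p_inf). -/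
/-- Proposition 4: for `α < -2`, if `p* > 0` solves the first-order
condition `(θp* - 1)·exp(α + θp*) = 1`, then `p* < p_inf = -α/θ`, and the revenue
satisfies `R(p*) > R(p_inf)`. -/
theorem logit_optimal_lt_inflection (μ θ α : ℝ) (hμ : 0 < μ) (hθ : 0 < θ)
    (hα : α < -2) (pstar : ℝ) (hpstar : 0 < pstar)
    (hfoc : (θ * pstar - 1) * Real.exp (α + θ * pstar) = 1) :
    pstar < -α / θ ∧
    (-α / θ) * (μ * Real.exp (-(α + θ * (-α / θ))) / (1 + Real.exp (-(α + θ * (-α / θ))))) <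
      pstar * (μ * Real.exp (-(α + θ * pstar)) / (1 + Real.exp (-(α + θ * pstar)))) := by
  have hneg : α + θ * pstar < 0 := by
    by_contra! h
    have h_one : 1 ≤ Real.exp (α + θ * pstar) := Real.one_le_exp h
    nlinarith
  have hexp : Real.exp (-(α + θ * pstar)) = θ * pstar - 1 := by
    rw [Real.exp_neg]
    exact inv_eq_of_mul_eq_one_left hfoc
  have hgap : -(α + θ * pstar) + 1 < Real.exp (-(α + θ * pstar)) :=
    Real.add_one_lt_exp (by linarith)
  have hinfl : α + θ * (-α / θ) = 0 := by
    field_simp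
    ring
  refine ⟨by rw [lt_div_iff₀ hθ]; linarith, ?_⟩
  rw [hinfl, hexp, neg_zero, Real.exp_zero]
  rw [hexp] at hgap
  have hstar : pstar * (μ * (θ * pstar - 1) / (1 + (θ * pstar - 1))) =
      μ * (θ * pstar - 1) / θ := by
    rw [add_sub_cancel]
    field_simp
  have hinfl_revenue : -α / θ * (μ * 1 / (1 + 1)) = μ * (-α / 2) / θ := by
    ring
  rw [hstar, hinfl_revenue]
  gcongr
  linarith
end
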